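/- Let n = 2k with k ≥ 6, let s be an integer with 2 ≤ s ≤ k−3, and let S1 = {1,…,s, n−s,…,n−1} and S2 = {k−s,…,k−1, k+1,…,k+s}. Then the circulant graphs G(ℤ_n, S1) and G(ℤ_n, S2) are singularly cospectral but not cospectral: the multisets of absolute values of the nonzero eigenvalues (with multiplicity) of their adjacency matrices coincide, but the multisets of all eigenvalues (with multiplicity) differ. -/

import Mathlib

open Polynomial

/-- Adjacency matrix (over ℝ) of the circulant graph `G(ℤ_n, S)`. -/
noncomputable def circAdj (n : ℕ) (S : Finset (ZMod n)) : Matrix (ZMod n) (ZMod n) ℝ :=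
  fun i j => if j - i ∈ S then 1 else 0

/-- Multiset of eigenvalues (with multiplicity) of the circulant graph `G(ℤ_n, S)`. -/
noncomputable def circSpectrum (n : ℕ) [NeZero n] (S : Finset (ZMod n)) : Multiset ℝ :=
  (Matrix.charpoly (circAdj n S)).roots

/-- Multiset of absolute values of the nonzero eigenvalues. -/
noncomputable def absNonzeroSpectrum (n : ℕ) [NeZero n] (S : Finset (ZMod n)) : Multiset ℝ :=
  ((circSpectrum n S).filter (fun x => x ≠ 0)).map (fun x => |x|)


section helpers

open Matrix

lemma h_trace_pow {m : Type*} [Fintype m] [DecidableEq m] (A : Matrix m m ℝ)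
    (hA : A.IsHermitian) : (A ^ 3).trace = (A.charpoly.roots.map (fun x => x ^ 3)).sum := by
  rw [hA.roots_charpoly_eq_eigenvalues]
  conv_lhs => rw [hA.spectral_theorem, ← map_pow, Unitary.conjStarAlgAut_apply,
    Matrix.trace_mul_comm, ← mul_assoc]
  simp [Matrix.diagonal_pow, Matrix.trace]

lemma h_charpoly_sq {m : Type*} [Fintype m] [DecidableEq m] (A B : Matrix m m ℝ)
    (h : A * A = B * B) :
    A.charpoly * A.charpoly.comp (-X) = B.charpoly * B.charpoly.comp (-X) := by
  apply Polynomial.funext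
  intro r
  have key : ∀ A : Matrix m m ℝ, (A.charpoly * A.charpoly.comp (-X)).eval r
      = (A * A - Matrix.scalar m (r * r)).det := by
    intro A
    rw [Polynomial.eval_mul, Polynomial.eval_comp, Matrix.eval_charpoly, Matrix.eval_charpoly,
      ← Matrix.det_mul]
    congr 1
    have hc : Matrix.scalar m r * A = A * Matrix.scalar m r :=
      (Matrix.scalar_commute r (fun x => mul_comm _ _) A).eq
    simp only [Polynomial.eval_neg, Polynomial.eval_X, map_neg, map_mul]
    rw [sub_mul, mul_sub, mul_sub, mul_neg, mul_neg, hc]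
    abel
  rw [key, key, h]

lemma h_abs {m : Type*} [Fintype m] [DecidableEq m] (A B : Matrix m m ℝ)
    (h : A * A = B * B) :
    A.charpoly.roots.map (fun x => |x|) = B.charpoly.roots.map (fun x => |x|) := by
  have h1 := congrArg Polynomial.roots (h_charpoly_sq A B h)
  have hne : ∀ A : Matrix m m ℝ, A.charpoly * A.charpoly.comp (-X) ≠ 0 := by
    intro A
    refine mul_ne_zero A.charpoly_monic.ne_zero ?_
    rw [Ne, Polynomial.comp_neg_X_eq_zero_iff]
    exact A.charpoly_monic.ne_zero
  rw [Polynomial.roots_mul (hne A), Polynomial.roots_mul (hne B), Polynomial.roots_comp_neg_X,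
    Polynomial.roots_comp_neg_X] at h1
  have h2 := congrArg (Multiset.map (fun x : ℝ => |x|)) h1
  simp only [Multiset.map_add, Multiset.map_map, Function.comp_def, abs_neg] at h2
  ext x
  have h3 := congrArg (Multiset.count x) h2
  simp only [Multiset.count_add] at h3
  omega

lemma h_filter (M : Multiset ℝ) : ((M.filter (fun x => x ≠ 0)).map (fun x => |x|))
    = (M.map (fun x => |x|)).filter (fun x => x ≠ 0) := by
  rw [Multiset.filter_map]
  congr 1
  apply Multiset.filter_congr
  intro x _
  simp

lemma h_mul_apply (n : ℕ) [NeZero n] (S T : Finset (ZMod n)) (i j : ZMod n) :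
    (circAdj n S * circAdj n T) i j
      = ∑ l, (if l - i ∈ S then (1 : ℝ) else 0) * (if j - l ∈ T then (1 : ℝ) else 0) := rfl

lemma h_sq (n : ℕ) [NeZero n] (S T : Finset (ZMod n)) (c : ZMod n) (hc : c + c = 0)
    (hST : ∀ x, x ∈ T ↔ x + c ∈ S) : circAdj n S * circAdj n S = circAdj n T * circAdj n T := by
  ext i j
  rw [h_mul_apply, h_mul_apply, ← Equiv.sum_comp (Equiv.addRight c)]
  refine Finset.sum_congr rfl fun l _ => ?_
  have e1 : l + c - i = l - i + c := by ring
  have e2 : j - (l + c) = j - l + c := by linear_combination -hc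
  simp only [Equiv.coe_addRight, hST, e1, e2]

lemma h_comm (n : ℕ) [NeZero n] (S T : Finset (ZMod n)) (c : ZMod n)
    (hST : ∀ x, x ∈ T ↔ x + c ∈ S) : circAdj n S * circAdj n T = circAdj n T * circAdj n S := by
  ext i j
  rw [h_mul_apply, h_mul_apply, ← Equiv.sum_comp (Equiv.addRight c)]
  refine Finset.sum_congr rfl fun l _ => ?_
  have e1 : l + c - i = l - i + c := by ring
  have e2 : j - (l + c) + c = j - l := by ring
  simp only [Equiv.coe_addRight, hST, e1, e2]

lemma h_cube {R : Type*} [Ring R] (A B : R) (h : A * A = B * B) (hc : A * B = B * A) :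
    (A - B) ^ 3 = 4 * (A ^ 3 - B ^ 3) := by
  have e1 : A * A * B = B ^ 3 := by rw [h]; noncomm_ring
  have e2 : A * B * B = A ^ 3 := by rw [mul_assoc, ← h]; noncomm_ring
  have e3 : (A - B) ^ 3 = A ^ 3 - 3 * (A * A * B) + 3 * (A * B * B) - B ^ 3 := by
    have a1 : A * B * A = A * A * B := by rw [mul_assoc, ← hc, mul_assoc]
    have a2 : B * A * A = A * A * B := by rw [← hc, a1]
    have a3 : B * B * A = A * B * B := by rw [mul_assoc, ← hc, ← mul_assoc, ← hc]
    have a4 : B * A * B = A * B * B := by rw [← hc]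
    have : (A - B) ^ 3 = A ^ 3 - (A * A * B + A * B * A + B * A * A)
        + (A * B * B + B * A * B + B * B * A) - B ^ 3 := by noncomm_ring
    rw [this, a1, a2, a3, a4]; noncomm_ring
  rw [e3, e1, e2]; noncomm_ring

lemma h_trace (n : ℕ) [NeZero n] (S : Finset (ZMod n)) (hS : ∀ x, -x ∈ S ↔ x ∈ S) :
    ((circAdj n S) ^ 3).trace
      = (n : ℝ) * ((∑ a ∈ S, (S.filter (fun b => a + b ∈ S)).card : ℕ) : ℝ) := by
  have h1 : ∀ i, ((circAdj n S) ^ 3) i i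
      = ((∑ a ∈ S, (S.filter (fun b => a + b ∈ S)).card : ℕ) : ℝ) := by
    intro i
    rw [pow_succ', pow_two, Matrix.mul_apply, ← Equiv.sum_comp (Equiv.addLeft i)]
    push_cast
    rw [← Finset.sum_filter_add_sum_filter_not Finset.univ (fun a => a ∈ S)]
    rw [Finset.sum_eq_zero (s := Finset.univ.filter (fun a => ¬ a ∈ S)), add_zero]
    · rw [Finset.filter_mem_eq_inter, Finset.univ_inter]
      refine Finset.sum_congr rfl fun a ha => ?_
      rw [h_mul_apply, ← Equiv.sum_comp (Equiv.addLeft (i + a))]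
      have e0 : circAdj n S i (i + a) = 1 := by simp [circAdj, ha]
      simp only [Equiv.coe_addLeft]
      rw [e0, one_mul, Finset.card_filter]
      push_cast
      rw [← Finset.sum_filter_add_sum_filter_not Finset.univ (fun a => a ∈ S)]
      rw [Finset.sum_eq_zero (s := Finset.univ.filter (fun a => ¬ a ∈ S)), add_zero]
      · rw [Finset.filter_mem_eq_inter, Finset.univ_inter]
        refine Finset.sum_congr rfl fun b hb => ?_
        have e1 : i + a + b - (i + a) = b := by ring
        have e2 : i - (i + a + b) = -(a + b) := by ring
        simp only [e1, e2, hS, hb, if_true, one_mul]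
      · intro b hb
        have hb : b ∉ S := by simpa using hb
        have e1 : i + a + b - (i + a) = b := by ring
        simp [e1, hb]
    · intro a ha
      have ha : a ∉ S := by simpa using ha
      simp [circAdj, ha]
  rw [Matrix.trace]
  simp only [Matrix.diag_apply, h1]
  simp [ZMod.card]

lemma h_symm (n : ℕ) [NeZero n] (S : Finset (ZMod n)) (hS : ∀ x, -x ∈ S ↔ x ∈ S) :
    (circAdj n S).IsHermitian := by
  ext i j
  have : i - j = -(j - i) := by ring
  simp only [circAdj, Matrix.conjTranspose_apply, star_trivial]
  simp only [this, hS]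

/-- The integers of absolute value between `1` and `t`. -/
noncomputable def intI (t : ℕ) : Finset ℤ := (Finset.Icc (-(t : ℤ)) t).erase 0

lemma mem_intI (t : ℕ) (z : ℤ) : z ∈ intI t ↔ z ≠ 0 ∧ -(t : ℤ) ≤ z ∧ z ≤ t := by
  simp [intI]

/-- The image of `intI t` in `ZMod n`. -/
noncomputable def cS (n t : ℕ) : Finset (ZMod n) := (intI t).image (fun z : ℤ => (z : ZMod n))

/-- The shift of `cS n t` by `k`. -/
noncomputable def cT (n k t : ℕ) : Finset (ZMod n) := (cS n t).image (fun z => z + (k : ZMod n))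

lemma h_cast_eq (k : ℕ) (a b : ℤ) (h : ((a : ℤ) : ZMod (2 * k)) = (b : ℤ)) :
    ∃ c : ℤ, a = b + 2 * k * c := by
  rw [ZMod.intCast_eq_intCast_iff_dvd_sub] at h
  obtain ⟨c, hc⟩ := h
  refine ⟨-c, ?_⟩
  push_cast at hc
  linarith

lemma h_small (k c x : ℤ) (hk : 0 < k) (h : x = k * c) (m : ℤ) (h1 : -(m * k) < x)
    (h2 : x < m * k) : -m < c ∧ c < m := by
  subst h
  constructor
  · nlinarith
  · nlinarith

lemma h_cast_inj (k : ℕ) (hk : 0 < k) (a b : ℤ) (h : ((a : ℤ) : ZMod (2 * k)) = (b : ℤ))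
    (h1 : a - b < 2 * k) (h2 : b - a < 2 * k) : a = b := by
  obtain ⟨c, hc⟩ := h_cast_eq k a b h
  have := h_small (2 * k) c (a - b) (by omega) (by linarith) 1 (by linarith) (by linarith)
  have hc0 : c = 0 := by omega
  subst hc0
  linarith

lemma h_injOn (k t : ℕ) (hk : 0 < k) (ht : t < k) (I : Finset ℤ)
    (hI : ∀ z ∈ I, -(t : ℤ) ≤ z ∧ z ≤ t) :
    Set.InjOn (fun z : ℤ => (z : ZMod (2 * k))) (I : Set ℤ) := by
  intro a ha b hb hab
  have h1 := hI a ha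
  have h2 := hI b hb
  exact h_cast_inj k hk a b hab (by omega) (by omega)

lemma h_kk (k : ℕ) : (k : ZMod (2 * k)) + k = 0 := by
  have := ZMod.natCast_self (2 * k)
  push_cast at this
  linear_combination this

lemma mem_cT (k t : ℕ) (x : ZMod (2 * k)) :
    x ∈ cT (2 * k) k t ↔ x + (k : ZMod (2 * k)) ∈ cS (2 * k) t := by
  have hkk := h_kk k
  constructor
  · intro h
    obtain ⟨y, hy, rfl⟩ := Finset.mem_image.1 h
    rwa [add_assoc, hkk, add_zero]
  · intro h
    exact Finset.mem_image.2 ⟨_, h, by rw [add_assoc, hkk, add_zero]⟩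

lemma neg_mem_cS (n t : ℕ) (x : ZMod n) : -x ∈ cS n t ↔ x ∈ cS n t := by
  have key : ∀ x : ZMod n, x ∈ cS n t → -x ∈ cS n t := by
    intro x h
    obtain ⟨y, hy, rfl⟩ := Finset.mem_image.1 h
    refine Finset.mem_image.2 ⟨-y, ?_, by push_cast; rfl⟩
    rw [mem_intI] at *
    omega
  exact ⟨fun h => by simpa using key _ h, key x⟩

lemma neg_mem_cT (k t : ℕ) (x : ZMod (2 * k)) : -x ∈ cT (2 * k) k t ↔ x ∈ cT (2 * k) k t := by
  rw [mem_cT, mem_cT, ← neg_mem_cS]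
  have : -(-x + (k : ZMod (2 * k))) = x + k := by linear_combination -h_kk k
  rw [this]

lemma F0_bound (k t : ℕ) (hk : 2 * t + 1 ≤ k) (z : ℤ) (hz : z ∈ intI t) :
    2 * t - 1 - z.natAbs ≤
      ((cS (2 * k) t).filter (fun b => (z : ZMod (2 * k)) + b ∈ cS (2 * k) t)).card := by
  rw [mem_intI] at hz
  set J : Finset ℤ := ((Finset.Icc (max (-(t : ℤ)) (-t - z)) (min (t : ℤ) (t - z))) \ {0, -z})
    with hJ
  have hmem : ∀ b ∈ J, b ≠ 0 ∧ b ≠ -z ∧ -(t : ℤ) ≤ b ∧ b ≤ t ∧ -(t : ℤ) ≤ z + b ∧ z + b ≤ t := by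
    intro b hb
    simp only [hJ, Finset.mem_sdiff, Finset.mem_Icc, Finset.mem_insert, Finset.mem_singleton] at hb
    omega
  have hcard : 2 * t - 1 - z.natAbs ≤ J.card := by
    have h1 := Finset.le_card_sdiff ({0, -z} : Finset ℤ)
      (Finset.Icc (max (-(t : ℤ)) (-t - z)) (min (t : ℤ) (t - z)))
    have h2 : ({0, -z} : Finset ℤ).card ≤ 2 := Finset.card_le_two
    rw [Int.card_Icc] at h1
    refine le_trans ?_ h1
    omega
  refine hcard.trans ?_
  rw [← Finset.card_image_of_injOn (h_injOn k t (by omega) (by omega) J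
    (fun b hb => by have := hmem b hb; omega))]
  apply Finset.card_le_card
  intro x hx
  obtain ⟨b, hb, rfl⟩ := Finset.mem_image.1 hx
  have := hmem b hb
  refine Finset.mem_filter.2 ⟨Finset.mem_image.2 ⟨b, ?_, rfl⟩,
    Finset.mem_image.2 ⟨z + b, ?_, by push_cast; rfl⟩⟩
  · rw [mem_intI]; omega
  · rw [mem_intI]; omega

lemma Fk_bound (k t : ℕ) (hk : 2 * t + 1 ≤ k) (z : ℤ) (hz : z ∈ intI t) :
    ((cS (2 * k) t).filter (fun b => (z : ZMod (2 * k)) + b + k ∈ cS (2 * k) t)).card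
      ≤ 2 * t + 1 + z.natAbs - k := by
  rw [mem_intI] at hz
  set J : Finset ℤ := if 0 < z then Finset.Icc (k - z - t) t else Finset.Icc (-t) (t - z - k)
    with hJ
  have hcard : J.card ≤ 2 * t + 1 + z.natAbs - k := by
    rw [hJ]
    split_ifs
    · rw [Int.card_Icc]; omega
    · rw [Int.card_Icc]; omega
  refine le_trans ?_ hcard
  refine le_trans (Finset.card_le_card ?_)
    (Finset.card_image_le (s := J) (f := fun z : ℤ => (z : ZMod (2 * k))))
  intro x hx
  obtain ⟨hx1, hx2⟩ := Finset.mem_filter.1 hx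
  obtain ⟨b, hb, rfl⟩ := Finset.mem_image.1 hx1
  obtain ⟨w, hw, hw2⟩ := Finset.mem_image.1 hx2
  rw [mem_intI] at hb hw
  refine Finset.mem_image.2 ⟨b, ?_, rfl⟩
  have hw3 : ((w : ℤ) : ZMod (2 * k)) = ((z + b + k : ℤ) : ZMod (2 * k)) := by
    push_cast; exact hw2
  obtain ⟨c, hc⟩ := h_cast_eq k _ _ hw3
  have h3 := h_small k (1 + 2 * c) (w - z - b) (by omega) (by linarith) 3 (by omega) (by omega)
  have hc' : c = 0 ∨ c = -1 := by omega
  rw [hJ]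
  split_ifs
  · rw [Finset.mem_Icc]
    rcases hc' with rfl | rfl <;> omega
  · rw [Finset.mem_Icc]
    rcases hc' with rfl | rfl <;> omega

lemma count_lt (k t : ℕ) (hk : 2 * t + 1 ≤ k) (hk6 : 6 ≤ k) (ht : 2 ≤ t) :
    ∑ z ∈ intI t, (2 * t + 1 + z.natAbs - k) < ∑ z ∈ intI t, (2 * t - 1 - z.natAbs) := by
  have h1 : ∑ z ∈ intI t, (2 * t + 1 + z.natAbs - k)
      = ∑ z ∈ intI t, (2 * t + 1 + (t + 1 - z.natAbs) - k) := by
    refine Finset.sum_nbij' (fun z => if 0 < z then t + 1 - z else -(t + 1) - z)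
      (fun z => if 0 < z then t + 1 - z else -(t + 1) - z) ?_ ?_ ?_ ?_ ?_
    all_goals
      intro z hz
      rw [mem_intI] at hz
      try rw [mem_intI]
      split_ifs <;> omega
  rw [h1]
  refine Finset.sum_lt_sum_of_nonempty ⟨1, ?_⟩ ?_
  · rw [mem_intI]; omega
  · intro z hz
    rw [mem_intI] at hz
    omega

lemma sum_lt (k t : ℕ) (hk : 2 * t + 1 ≤ k) (hk6 : 6 ≤ k) (ht : 2 ≤ t) :
    ∑ a ∈ cT (2 * k) k t, ((cT (2 * k) k t).filter (fun b => a + b ∈ cT (2 * k) k t)).card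
      < ∑ a ∈ cS (2 * k) t, ((cS (2 * k) t).filter (fun b => a + b ∈ cS (2 * k) t)).card := by
  have hinj := h_injOn k t (by omega) (by omega) (intI t)
    (fun z hz => by rw [mem_intI] at hz; omega)
  have hkk := h_kk k
  have e1 : ∑ a ∈ cT (2 * k) k t,
      ((cT (2 * k) k t).filter (fun b => a + b ∈ cT (2 * k) k t)).card
      = ∑ a ∈ cS (2 * k) t, ((cS (2 * k) t).filter (fun b => a + b + k ∈ cS (2 * k) t)).card := by
    have hF : ∀ F : ZMod (2 * k) → ℕ,
        ∑ a ∈ cT (2 * k) k t, F a = ∑ a ∈ cS (2 * k) t, F (a + k) := by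
      intro F
      rw [cT, Finset.sum_image (fun a _ b _ h => add_right_cancel h)]
    rw [hF]
    refine Finset.sum_congr rfl fun a _ => ?_
    refine Finset.card_nbij' (fun b => b + k) (fun b => b + k) ?_ ?_ ?_ ?_
    · intro b hb
      simp only [Finset.coe_filter, Set.mem_ofPred_eq, mem_cT] at hb ⊢
      refine ⟨hb.1, ?_⟩
      have : a + (b + k) + k = a + k + b + (k : ZMod (2 * k)) := by ring
      rw [this]; exact hb.2
    · intro b hb
      simp only [Finset.coe_filter, Set.mem_ofPred_eq, mem_cT] at hb ⊢
      have h1 : b + k + k = b := by linear_combination hkk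
      have h2 : a + k + (b + k) + k = a + b + (k : ZMod (2 * k)) := by linear_combination hkk
      rw [h1, h2]; exact hb
    · intro b _
      simp only
      linear_combination hkk
    · intro b _
      simp only
      linear_combination hkk
  rw [e1]
  have hG : ∀ F : ZMod (2 * k) → ℕ,
      ∑ a ∈ cS (2 * k) t, F a = ∑ z ∈ intI t, F (z : ZMod (2 * k)) := by
    intro F
    rw [cS, Finset.sum_image hinj]
  rw [hG, hG]
  refine lt_of_le_of_lt (Finset.sum_le_sum fun z hz => Fk_bound k t hk z hz) ?_
  exact lt_of_lt_of_le (count_lt k t hk hk6 ht) (Finset.sum_le_sum fun z hz => F0_bound k t hk z hz)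

lemma trace_ne (k t : ℕ) [NeZero (2 * k)] (hk : 2 * t + 1 ≤ k) (hk6 : 6 ≤ k) (ht : 2 ≤ t) :
    (circAdj (2 * k) (cS (2 * k) t) ^ 3).trace ≠ (circAdj (2 * k) (cT (2 * k) k t) ^ 3).trace := by
  rw [h_trace _ _ (neg_mem_cS (2 * k) t), h_trace _ _ (neg_mem_cT k t)]
  intro h
  have h0 : ((2 * k : ℕ) : ℝ) ≠ 0 := by exact_mod_cast NeZero.ne (2 * k)
  have h1 := mul_left_cancel₀ h0 h
  have h2 := sum_lt k t hk hk6 ht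
  have h3 := Nat.cast_injective h1
  omega

lemma cube_diff (k t : ℕ) [NeZero (2 * k)] :
    4 * ((circAdj (2 * k) (cS (2 * k) t) ^ 3).trace
      - (circAdj (2 * k) (cT (2 * k) k t) ^ 3).trace)
    = ((circAdj (2 * k) (cS (2 * k) t) - circAdj (2 * k) (cT (2 * k) k t)) ^ 3).trace := by
  rw [h_cube _ _ (h_sq _ _ _ _ (h_kk k) (mem_cT k t)) (h_comm _ _ _ _ (mem_cT k t)),
    ← Matrix.trace_sub]
  have : (4 : Matrix (ZMod (2 * k)) (ZMod (2 * k)) ℝ) = (4 : ℝ) • 1 := by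
    rw [← Algebra.algebraMap_eq_smul_one]; exact (map_ofNat (algebraMap ℝ _) 4).symm
  rw [this, smul_mul_assoc, one_mul, Matrix.trace_smul, smul_eq_mul]

/-- Complementation: only elements outside `0` and `k` matter, and `s`, `k - 1 - s` are dual. -/
lemma mem_compl (k s t : ℕ) (hst : s + t + 1 = k) (x : ZMod (2 * k)) (hx0 : x ≠ 0)
    (hxk : x ≠ k) : x ∈ cS (2 * k) s ↔ x ∉ cT (2 * k) k t := by
  rw [mem_cT]
  have : NeZero (2 * k) := ⟨by omega⟩
  obtain ⟨z, hz, hzl, hzu⟩ : ∃ z : ℤ, (z : ZMod (2 * k)) = x ∧ -(k : ℤ) < z ∧ z ≤ k := by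
    refine ⟨x.valMinAbs, ZMod.coe_valMinAbs x, ?_⟩
    have := ZMod.valMinAbs_mem_Ioc x
    rw [Set.mem_Ioc] at this
    push_cast at this
    omega
  have hz0 : z ≠ 0 := by rintro rfl; exact hx0 (by rw [← hz]; simp)
  have hzk : z ≠ k := by rintro rfl; exact hxk (by rw [← hz]; simp)
  subst hz
  have m1 : (z : ZMod (2 * k)) ∈ cS (2 * k) s ↔ z ∈ intI s := by
    constructor
    · intro h
      obtain ⟨w, hw, hwz⟩ := Finset.mem_image.1 h
      rw [mem_intI] at hw
      have := h_cast_inj k (by omega) w z hwz (by omega) (by omega)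
      subst this
      rw [mem_intI]; exact hw
    · intro h
      exact Finset.mem_image.2 ⟨z, h, rfl⟩
  have m2 : (z : ZMod (2 * k)) + k ∈ cS (2 * k) t ↔
      (if 0 < z then z - k else z + k) ∈ intI t := by
    have hcast : (z : ZMod (2 * k)) + k
        = (((if 0 < z then z - k else z + k : ℤ)) : ZMod (2 * k)) := by
      split_ifs
      · push_cast; linear_combination h_kk k
      · push_cast; rfl
    rw [hcast]
    constructor
    · intro h
      obtain ⟨w, hw, hwz⟩ := Finset.mem_image.1 h
      rw [mem_intI] at hw
      have := h_cast_inj k (by omega) w _ hwz (by split_ifs <;> omega) (by split_ifs <;> omega)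
      rw [← this]
      rw [mem_intI]; exact hw
    · intro h
      exact Finset.mem_image.2 ⟨_, h, rfl⟩
  rw [m1, m2, mem_intI, mem_intI]
  split_ifs <;> omega

lemma k_ne (k s : ℕ) (hs : s < k) : (0 : ZMod (2 * k)) ∉ cS (2 * k) s ∧
    (k : ZMod (2 * k)) ∉ cS (2 * k) s := by
  constructor
  · intro h
    obtain ⟨w, hw, hwz⟩ := Finset.mem_image.1 h
    rw [mem_intI] at hw
    have := h_cast_inj k (by omega) w 0 (by simpa using hwz) (by omega) (by omega)
    omega
  · intro h
    obtain ⟨w, hw, hwz⟩ := Finset.mem_image.1 h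
    rw [mem_intI] at hw
    have := h_cast_inj k (by omega) w k (by simpa using hwz) (by omega) (by omega)
    omega

lemma diff_eq (k s t : ℕ) (hst : s + t + 1 = k) :
    circAdj (2 * k) (cS (2 * k) s) - circAdj (2 * k) (cT (2 * k) k s)
      = circAdj (2 * k) (cS (2 * k) t) - circAdj (2 * k) (cT (2 * k) k t) := by
  ext i j
  simp only [Matrix.sub_apply, circAdj]
  generalize j - i = x
  have a1 := k_ne k s (by omega)
  have a2 := k_ne k t (by omega)
  have hkk := h_kk k
  by_cases hx0 : x = 0
  · subst hx0
    simp [mem_cT, a1, a2]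
  by_cases hxk : x = k
  · subst hxk
    simp [mem_cT, a1, a2, hkk]
  have b1 := mem_compl k s t hst x hx0 hxk
  have b2 := mem_compl k t s (by omega) x hx0 hxk
  by_cases c1 : x ∈ cT (2 * k) k s <;> by_cases c2 : x ∈ cT (2 * k) k t <;>
    simp [b1, b2, c1, c2]

lemma trace_ne' (k s : ℕ) [NeZero (2 * k)] (hk6 : 6 ≤ k) (hs : 2 ≤ s) (hs' : s + 3 ≤ k) :
    (circAdj (2 * k) (cS (2 * k) s) ^ 3).trace ≠ (circAdj (2 * k) (cT (2 * k) k s) ^ 3).trace := by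
  by_cases h : 2 * s + 1 ≤ k
  · exact trace_ne k s h hk6 hs
  · obtain ⟨t, ht⟩ : ∃ t, s + t + 1 = k := ⟨k - 1 - s, by omega⟩
    have h1 := trace_ne k t (by omega) hk6 (by omega)
    intro h2
    apply h1
    have e1 := cube_diff k s
    have e2 := cube_diff k t
    rw [diff_eq k s t ht, ← e2] at e1
    linarith

lemma S1_eq (k s : ℕ) (hs : s < k) :
    (((Finset.Icc 1 s).image fun h : ℕ => (h : ZMod (2 * k))) ∪
      ((Finset.Icc (2 * k - s) (2 * k - 1)).image fun h : ℕ => (h : ZMod (2 * k))))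
      = cS (2 * k) s := by
  have h2k : ((2 * k : ℕ) : ZMod (2 * k)) = 0 := ZMod.natCast_self (2 * k)
  push_cast at h2k
  ext x
  simp only [cS, Finset.mem_union, Finset.mem_image, Finset.mem_Icc, mem_intI]
  constructor
  · rintro (⟨h, hh, rfl⟩ | ⟨h, hh, rfl⟩)
    · exact ⟨h, by omega, by simp⟩
    · exact ⟨(h : ℤ) - (2 * k : ℤ), by omega, by push_cast; linear_combination -h2k⟩
  · rintro ⟨z, hz, rfl⟩
    by_cases h0 : 0 < z
    · left
      obtain ⟨m, rfl⟩ := Int.eq_ofNat_of_zero_le h0.le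
      exact ⟨m, by omega, by simp⟩
    · right
      obtain ⟨m, hm⟩ := Int.eq_ofNat_of_zero_le (a := z + 2 * k) (by omega)
      refine ⟨m, by omega, ?_⟩
      have : ((m : ℤ) : ZMod (2 * k)) = ((z + 2 * k : ℤ) : ZMod (2 * k)) := by rw [hm]
      push_cast at this
      rw [this]; linear_combination h2k

lemma S2_eq (k s : ℕ) (hs : s < k) :
    (((Finset.Icc (k - s) (k - 1)).image fun h : ℕ => (h : ZMod (2 * k))) ∪
      ((Finset.Icc (k + 1) (k + s)).image fun h : ℕ => (h : ZMod (2 * k))))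
      = cT (2 * k) k s := by
  ext x
  simp only [cT, cS, Finset.mem_union, Finset.mem_image, Finset.mem_Icc, mem_intI]
  constructor
  · rintro (⟨h, hh, rfl⟩ | ⟨h, hh, rfl⟩)
    · exact ⟨_, ⟨(h : ℤ) - k, by omega, rfl⟩, by push_cast; ring⟩
    · exact ⟨_, ⟨(h : ℤ) - k, by omega, rfl⟩, by push_cast; ring⟩
  · rintro ⟨_, ⟨z, hz, rfl⟩, rfl⟩
    obtain ⟨m, hm⟩ := Int.eq_ofNat_of_zero_le (a := z + k) (by omega)
    have : ((m : ℤ) : ZMod (2 * k)) = ((z + k : ℤ) : ZMod (2 * k)) := by rw [hm]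
    push_cast at this
    by_cases h0 : 0 < z
    · right
      exact ⟨m, by omega, this⟩
    · left
      exact ⟨m, by omega, this⟩

end helpers

theorem stmt17 (k s n : ℕ) [NeZero n] (hk : 6 ≤ k) (hn : n = 2 * k)
    (hs2 : 2 ≤ s) (hsk : s ≤ k - 3)
    (S1 S2 : Finset (ZMod n))
    (hS1 : S1 = ((Finset.Icc 1 s).image fun h : ℕ => (h : ZMod n)) ∪
                ((Finset.Icc (n - s) (n - 1)).image fun h : ℕ => (h : ZMod n)))
    (hS2 : S2 = ((Finset.Icc (k - s) (k - 1)).image fun h : ℕ => (h : ZMod n)) ∪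
                ((Finset.Icc (k + 1) (k + s)).image fun h : ℕ => (h : ZMod n))) :
    absNonzeroSpectrum n S1 = absNonzeroSpectrum n S2 ∧
      circSpectrum n S1 ≠ circSpectrum n S2 := by

  subst hn
  rw [S1_eq k s (by omega)] at hS1
  rw [S2_eq k s (by omega)] at hS2
  subst hS1 hS2
  constructor
  · unfold absNonzeroSpectrum circSpectrum
    rw [h_filter, h_filter, h_abs _ _ (h_sq _ _ _ _ (h_kk k) (mem_cT k s))]
  · intro h
    unfold circSpectrum at h
    apply trace_ne' k s hk hs2 (by omega)
    rw [h_trace_pow _ (h_symm _ _ (neg_mem_cS (2 * k) s)),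
      h_trace_pow _ (h_symm _ _ (neg_mem_cT k s)), h]
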